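/- Let B and A be directed algebras, Λ = 𝒜(B, A^op), and let P_B^• → L_B(i) be a minimal projective resolution whose k-th term is P_B^k = ⊕_{ℓ=1}^n P_B(ℓ)^{⊕ m_{ℓ,k}}. Then for every j and every k ≥ 0 there is an isomorphism of K-vector spaces Ext^k_Λ(Δ_Λ(i), Δ_Λ(j)) ≅ ⊕_{ℓ=1}^n (e_j A e_ℓ)^{⊕ m_{ℓ,k}}. In particular, the complex Hom_Λ(Λ ⊗_B P_B^•, Δ_Λ(j)) computing these Ext groups has zero differential. -/

import Mathlib

noncomputable section

universe u

/-- Data of a complete set of orthogonal idempotents indexed by the vertices `Fin n`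
of a quiver, inside a `K`-algebra. -/
structure IdemData (K : Type u) [Field K] (n : ℕ) (B : Type u) [Ring B] [Algebra K B] where
  e : Fin n → B
  orth : ∀ i j, e i * e j = if i = j then e i else 0
  complete : ∑ i, e i = 1

namespace IdemData

variable {K : Type u} [Field K] {n : ℕ} {B : Type u} [Ring B] [Algebra K B]

/-- Membership in the radical of a directed algebra: all "diagonal components" vanish.
For a directed (triangular, basic) algebra this is exactly the Jacobson radical. -/
def IsRad (d : IdemData K n B) (b : B) : Prop := ∀ i, d.e i * b * d.e i = 0

/-- A directed algebra: finite dimensional, basic, whose (Gabriel) quiver is acyclic with all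
arrows `i ⟶ j` satisfying `i < j`.  Equivalently: `e j * B * e i = 0` for `j < i` and the
"diagonal" components `e i * B * e i` are one-dimensional. -/
def Directed (d : IdemData K n B) : Prop :=
  FiniteDimensional K B ∧
  (∀ i j : Fin n, j < i → ∀ b : B, d.e j * b * d.e i = 0) ∧
  (∀ i : Fin n, ∀ b : B, ∃ c : K, d.e i * b * d.e i = c • d.e i)

/-- The opposite of a directed algebra (all arrows decrease); `A^op` for `A` directed. -/
def Codirected (d : IdemData K n B) : Prop :=
  FiniteDimensional K B ∧
  (∀ i j : Fin n, i < j → ∀ b : B, d.e j * b * d.e i = 0) ∧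
  (∀ i : Fin n, ∀ b : B, ∃ c : K, d.e i * b * d.e i = c • d.e i)

/-- The indecomposable projective left module `P(i) = B·e i`, realized as the left ideal
`{x | x * e i = x}`. -/
def proj (d : IdemData K n B) (i : Fin n) : Submodule B B where
  carrier := {x | x * d.e i = x}
  add_mem' := by
    intro a b ha hb
    simp only [Set.mem_setOf_eq] at *
    rw [add_mul, ha, hb]
  zero_mem' := by simp
  smul_mem' := by
    intro c x hx
    simp only [Set.mem_setOf_eq, smul_eq_mul] at *
    rw [mul_assoc, hx]

end IdemData

/-- The bilinear "multiplication" map `C ⊗ B → Λ`, `(c, b) ↦ ιC c * ιB b`. -/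
def dualBil {K : Type u} [Field K] {B C L : Type u} [Ring B] [Algebra K B] [Ring C] [Algebra K C]
    [Ring L] [Algebra K L] (ιB : B →ₐ[K] L) (ιC : C →ₐ[K] L) : C →ₗ[K] B →ₗ[K] L :=
  LinearMap.mk₂ K (fun c b => ιC c * ιB b)
    (fun c c' b => by simp only [map_add, add_mul])
    (fun k c b => by simp only [map_smul, smul_mul_assoc])
    (fun c b b' => by simp only [map_add, mul_add])
    (fun k c b => by simp only [map_smul, mul_smul_comm])

/-- `Λ` is the dual extension algebra `𝒜(B, C)` of `B` and `C` (in the paper `C = A^op`):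
`B` and `C` embed as subalgebras, sharing the idempotents; the product of a radical element of
`B` with a radical element of `C` (in this order; i.e. all paths `α β'`) vanishes; and the
products `ιC c * ιB b` span `Λ`, the only linear relations among them being the ones forced by
`ιC (c e_i) * ιB (e_j b) = 0` for `i ≠ j`.  This encodes `Λ ≅ ⊕_i C e_i ⊗ e_i B` as in
`Definition 2.1` of the paper. -/
structure DualExt (K : Type u) [Field K] (n : ℕ) (B C L : Type u) [Ring B] [Algebra K B]
    [Ring C] [Algebra K C] [Ring L] [Algebra K L]
    (dB : IdemData K n B) (dC : IdemData K n C) where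
  ιB : B →ₐ[K] L
  ιC : C →ₐ[K] L
  injB : Function.Injective ιB
  injC : Function.Injective ιC
  idem : ∀ i, ιB (dB.e i) = ιC (dC.e i)
  radMul : ∀ b c, dB.IsRad b → dC.IsRad c → ιB b * ιC c = 0
  spans : Submodule.span K {x : L | ∃ c b, x = ιC c * ιB b} = ⊤
  mulKer : LinearMap.ker (TensorProduct.lift (dualBil ιB ιC)) =
    Submodule.span K {x : TensorProduct K C B |
      ∃ i j : Fin n, i ≠ j ∧ ∃ c b, x = (c * dC.e i) ⊗ₜ[K] (dB.e j * b)}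

/-- The left ideal `{x | x * a = x}`; for an idempotent `a = e i` this is the
indecomposable projective module `P(i) = B e i`. -/
def leftIdeal {L : Type u} [Ring L] (a : L) : Submodule L L where
  carrier := {x | x * a = x}
  add_mem' := by
    intro x y hx hy
    simp only [Set.mem_setOf_eq] at *
    rw [add_mul, hx, hy]
  zero_mem' := by simp
  smul_mem' := by
    intro c x hx
    simp only [Set.mem_setOf_eq, smul_eq_mul] at *
    rw [mul_assoc, hx]
/-- A projective resolution `⋯ → P 1 → P 0 → M → 0` of the module `M` over `R`. -/
structure ProjRes (K : Type u) [Field K] (R : Type u) [Ring R] [Algebra K R]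
    (M : Type u) [AddCommGroup M] [Module R M] where
  P : ℕ → Type u
  [acg : ∀ k, AddCommGroup (P k)]
  [mod : ∀ k, Module R (P k)]
  d : ∀ k, P (k + 1) →ₗ[R] P k
  aug : P 0 →ₗ[R] M
  proj : ∀ k, Module.Projective R (P k)
  aug_surj : Function.Surjective aug
  exact0 : LinearMap.ker aug = LinearMap.range (d 0)
  exact : ∀ k, LinearMap.ker (d k) = LinearMap.range (d (k + 1))

attribute [instance] ProjRes.acg ProjRes.mod

/-- Minimality of a projective resolution: the differentials are radical maps,
`im (d k) ⊆ rad R · P k` (the radical being described by the idempotent data). -/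
def ProjRes.Minimal {K : Type u} [Field K] {R : Type u} [Ring R] [Algebra K R]
    {M : Type u} [AddCommGroup M] [Module R M] {n : ℕ}
    (dd : IdemData K n R) (Q : ProjRes K R M) : Prop :=
  ∀ k, LinearMap.range (Q.d k) ≤
    Submodule.span R {x : Q.P k | ∃ b m, dd.IsRad b ∧ x = b • m}

/-- `S` is (a copy of) the simple module `L(i)` at the vertex `i`: it is simple and the
idempotent `e i` acts as the identity on it. -/
def IdemData.IsSimpleAt {K : Type u} [Field K] {n : ℕ} {B : Type u} [Ring B] [Algebra K B]
    (d : IdemData K n B) (i : Fin n) (S : Type u) [AddCommGroup S] [Module B S] : Prop :=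
  IsSimpleModule B S ∧ ∀ s : S, d.e i • s = s

/-- The standard module `Δ_Λ(i) = Λe_i / Λ·(rad B)·e_i` of the dual extension algebra
(the quotient of the indecomposable projective `P_Λ(i)` by the span of the images of all
maps from `P_Λ(j)`, `j > i`, equivalently by `Λ·(rad B)·e i`). -/
def DualExt.std {K : Type u} [Field K] {n : ℕ} {B C L : Type u} [Ring B] [Algebra K B]
    [Ring C] [Algebra K C] [Ring L] [Algebra K L] {dB : IdemData K n B} {dC : IdemData K n C}
    (D : DualExt K n B C L dB dC) (i : Fin n) : Type u :=
  ↥(leftIdeal (D.ιB (dB.e i))) ⧸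
    ((Submodule.span L {x : L | ∃ b, dB.IsRad b ∧ x = D.ιB b * D.ιB (dB.e i)}).comap
      (leftIdeal (D.ιB (dB.e i))).subtype)

noncomputable instance {K : Type u} [Field K] {n : ℕ} {B C L : Type u} [Ring B] [Algebra K B]
    [Ring C] [Algebra K C] [Ring L] [Algebra K L] {dB : IdemData K n B} {dC : IdemData K n C}
    (D : DualExt K n B C L dB dC) (i : Fin n) : AddCommGroup (D.std i) :=
  by unfold DualExt.std; infer_instance

noncomputable instance {K : Type u} [Field K] {n : ℕ} {B C L : Type u} [Ring B] [Algebra K B]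
    [Ring C] [Algebra K C] [Ring L] [Algebra K L] {dB : IdemData K n B} {dC : IdemData K n C}
    (D : DualExt K n B C L dB dC) (i : Fin n) : Module L (D.std i) :=
  by unfold DualExt.std; infer_instance

section stdInstances

variable {K : Type u} [Field K] {n : ℕ} {B C L : Type u} [Ring B] [Algebra K B]
  [Ring C] [Algebra K C] [Ring L] [Algebra K L] {dB : IdemData K n B} {dC : IdemData K n C}

noncomputable instance (D : DualExt K n B C L dB dC) (i : Fin n) : Module K (D.std i) :=
  Module.compHom _ (algebraMap K L)

instance (D : DualExt K n B C L dB dC) (i : Fin n) : SMulCommClass L K (D.std i) := by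
  constructor
  intro l k x
  show l • (algebraMap K L k • x) = algebraMap K L k • (l • x)
  rw [← mul_smul, ← mul_smul, Algebra.commutes]

instance (D : DualExt K n B C L dB dC) (i : Fin n) : IsScalarTower K L (D.std i) := by
  constructor
  intro k l x
  show (k • l) • x = algebraMap K L k • l • x
  rw [← mul_smul, Algebra.smul_def]

end stdInstances

/-- The "corner" subspace `e·X·f = {x | e * x * f = x}` of an algebra, e.g. `e j * A * e ℓ`. -/
def cornerSpace (K : Type u) [Field K] {A : Type u} [Ring A] [Algebra K A] (e f : A) :
    Submodule K A where
  carrier := {x | e * x * f = x}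
  add_mem' := by
    intro x y hx hy
    simp only [Set.mem_setOf_eq] at *
    rw [mul_add, add_mul, hx, hy]
  zero_mem' := by simp
  smul_mem' := by
    intro c x hx
    simp only [Set.mem_setOf_eq] at *
    rw [mul_smul_comm, smul_mul_assoc, hx]

section helpers

namespace IdemData

variable {K : Type} [Field K] {n : ℕ} {B : Type} [Ring B] [Algebra K B] (d : IdemData K n B)

lemma e_self (i : Fin n) : d.e i * d.e i = d.e i := by simp [d.orth]

lemma e_ne {i j : Fin n} (h : i ≠ j) : d.e i * d.e j = 0 := by simp [d.orth, h]

lemma isRad_zero : d.IsRad 0 := fun i => by simp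

lemma isRad_add {a b : B} (ha : d.IsRad a) (hb : d.IsRad b) : d.IsRad (a + b) := fun i => by
  rw [mul_add, add_mul, ha i, hb i, add_zero]

lemma isRad_neg {a : B} (ha : d.IsRad a) : d.IsRad (-a) := fun i => by
  rw [mul_neg, neg_mul, ha i, neg_zero]

lemma isRad_smul (k : K) {a : B} (ha : d.IsRad a) : d.IsRad (k • a) := fun i => by
  rw [mul_smul_comm, smul_mul_assoc, ha i, smul_zero]

lemma isRad_sum {ι : Type*} (s : Finset ι) (f : ι → B) (h : ∀ x ∈ s, d.IsRad (f x)) :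
    d.IsRad (∑ x ∈ s, f x) := by
  classical
  induction s using Finset.induction_on with
  | empty => simpa using d.isRad_zero
  | insert a s ha ih =>
    rw [Finset.sum_insert ha]
    exact d.isRad_add (h _ (by simp)) (ih fun x hx => h x (by simp [hx]))

lemma sum_mul_e (b : B) : ∑ p, b * d.e p = b := by
  rw [← Finset.mul_sum, d.complete, mul_one]

lemma sum_e_mul (b : B) : ∑ p, d.e p * b = b := by
  rw [← Finset.sum_mul, d.complete, one_mul]

lemma mul_split (a b : B) : ∑ k, a * d.e k * (d.e k * b) = a * b := by
  calc _ = ∑ k, a * (d.e k * b) := by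
        refine Finset.sum_congr rfl fun k _ => ?_
        rw [mul_assoc, ← mul_assoc (d.e k), d.e_self]
    _ = a * b := by rw [← Finset.mul_sum, d.sum_e_mul]

/-- triangular either way -/
lemma isRad_mul_right_of
    (h : ∀ i k : Fin n, i ≠ k → ∀ a b : B, d.e i * a * d.e k * (d.e k * b * d.e i) = 0)
    {a : B} (ha : d.IsRad a) (b : B) : d.IsRad (a * b) ∧ d.IsRad (b * a) := by
  constructor
  · intro i
    have := d.mul_split (d.e i * a) (b * d.e i)
    rw [show d.e i * (a * b) * d.e i = d.e i * a * (b * d.e i) by noncomm_ring, ← this]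
    refine Finset.sum_eq_zero fun k _ => ?_
    by_cases hk : i = k
    · subst hk; rw [ha, zero_mul]
    · rw [← mul_assoc (d.e k)]; exact h i k hk a b
  · intro i
    have := d.mul_split (d.e i * b) (a * d.e i)
    rw [show d.e i * (b * a) * d.e i = d.e i * b * (a * d.e i) by noncomm_ring, ← this]
    refine Finset.sum_eq_zero fun k _ => ?_
    by_cases hk : i = k
    · subst hk; rw [← mul_assoc (d.e i) a, ha, mul_zero]
    · rw [← mul_assoc (d.e k)]; exact h i k hk b a

variable {d}

lemma Directed.mul_rad (h : d.Directed) {a : B} (ha : d.IsRad a) (b : B) :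
    d.IsRad (a * b) ∧ d.IsRad (b * a) := by
  refine d.isRad_mul_right_of (fun i k hk a b => ?_) ha b
  rcases lt_or_gt_of_ne hk with h1 | h1
  · rw [h.2.1 k i h1, zero_mul]
  · rw [h.2.1 i k h1, mul_zero]

lemma Codirected.mul_rad (h : d.Codirected) {a : B} (ha : d.IsRad a) (b : B) :
    d.IsRad (a * b) ∧ d.IsRad (b * a) := by
  refine d.isRad_mul_right_of (fun i k hk a b => ?_) ha b
  rcases lt_or_gt_of_ne hk with h1 | h1
  · rw [h.2.1 i k h1, mul_zero]
  · rw [h.2.1 k i h1, zero_mul]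

lemma diag_of (h : ∀ i : Fin n, ∀ b : B, ∃ c : K, d.e i * b * d.e i = c • d.e i) (b : B) :
    ∃ κ : Fin n → K, d.IsRad (b - ∑ p, κ p • d.e p) := by
  choose f hf using h
  refine ⟨fun p => f p b, fun i => ?_⟩
  have : d.e i * (∑ p, f p b • d.e p) * d.e i = f i b • d.e i := by
    rw [Finset.mul_sum, Finset.sum_mul, Finset.sum_eq_single i]
    · simp [d.e_self]
    · intro p _ hp
      simp [d.e_ne hp.symm]
    · simp
  rw [mul_sub, sub_mul, this, hf, sub_self]

/-- A `K`-combination of idempotents which is radical vanishes. -/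
lemma diag_rad_zero {κ : Fin n → K} (h : d.IsRad (∑ p, κ p • d.e p)) (i : Fin n) :
    κ i • d.e i = 0 := by
  have : d.e i * (∑ p, κ p • d.e p) * d.e i = κ i • d.e i := by
    rw [Finset.mul_sum, Finset.sum_mul, Finset.sum_eq_single i]
    · simp [d.e_self]
    · intro p _ hp
      simp [d.e_ne hp.symm]
    · simp
  rw [← this, h i]

end IdemData

/-- An adapted basis of the radical of `C`. -/
structure RadBasis {K : Type} [Field K] {n : ℕ} {C : Type} [Ring C] [Algebra K C]
    (d : IdemData K n C) where
  T : Type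
  fin : Fintype T
  s : T → Fin n
  c : T → C
  rad : ∀ t, d.IsRad (c t)
  src : ∀ t, c t * d.e (s t) = c t
  expand : ∀ x, d.IsRad x → ∃ κ : T → K, x = ∑ t, κ t • c t
  dual : T → C →ₗ[K] K
  dual_self : ∀ t, dual t (c t) = 1
  dual_ne : ∀ t t', t ≠ t' → dual t (c t') = 0
  dual_e : ∀ t p, dual t (d.e p) = 0

attribute [instance] RadBasis.fin

lemma exists_radBasis {K : Type} [Field K] {n : ℕ} {C : Type} [Ring C] [Algebra K C]
    (d : IdemData K n C) (hd : d.Codirected) : Nonempty (RadBasis d) := by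
  classical
  have := hd.1
  let R : Fin n → Submodule K C := fun p =>
    { carrier := {x | d.IsRad x ∧ x * d.e p = x}
      add_mem' := fun {a b} ha hb => ⟨d.isRad_add ha.1 hb.1, by rw [add_mul, ha.2, hb.2]⟩
      zero_mem' := ⟨d.isRad_zero, by simp⟩
      smul_mem' := fun k a ha => ⟨d.isRad_smul k ha.1, by rw [smul_mul_assoc, ha.2]⟩ }
  let f : Fin n → C →ₗ[K] C := fun p =>
    { toFun := fun x => (x - ∑ q, d.e q * x * d.e q) * d.e p
      map_add' := fun x y => by
        simp only [mul_add, add_mul, Finset.sum_add_distrib, sub_mul]; abel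
      map_smul' := fun k x => by
        simp only [mul_smul_comm, smul_mul_assoc, ← Finset.smul_sum, ← smul_sub, RingHom.id_apply] }
  have hf : ∀ p x, f p x ∈ R p := by
    intro p x
    refine ⟨(hd.mul_rad ?_ _).1, ?_⟩
    · intro i
      have : d.e i * (∑ q, d.e q * x * d.e q) * d.e i = d.e i * x * d.e i := by
        rw [Finset.mul_sum, Finset.sum_mul, Finset.sum_eq_single i]
        · rw [← mul_assoc, ← mul_assoc, d.e_self, mul_assoc, d.e_self]
        · intro q _ hq
          rw [← mul_assoc, ← mul_assoc, d.e_ne hq.symm]; simp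
        · simp
      rw [mul_sub, sub_mul, this, sub_self]
    · show (x - ∑ q, d.e q * x * d.e q) * d.e p * d.e p = _
      rw [mul_assoc, d.e_self]; rfl
  have hfr : ∀ p x, d.IsRad x → f p x = x * d.e p := by
    intro p x hx
    show (x - ∑ q, d.e q * x * d.e q) * d.e p = _
    rw [Finset.sum_eq_zero fun q _ => hx q, sub_zero]
  have hfe : ∀ p q, f p (d.e q) = 0 := by
    intro p q
    show (d.e q - ∑ r, d.e r * d.e q * d.e r) * d.e p = _
    rw [Finset.sum_eq_single q]
    · simp [d.e_self]
    · intro r _ hr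
      simp [d.e_ne hr]
    · simp
  let g : ∀ p, C →ₗ[K] R p := fun p => (f p).codRestrict (R p) (hf p)
  let bs : ∀ p, Module.Basis (Fin (Module.finrank K (R p))) K (R p) := fun p => Module.finBasis K (R p)
  refine ⟨{
    T := Σ p, Fin (Module.finrank K (R p))
    fin := inferInstance
    s := fun t => t.1
    c := fun t => (bs t.1 t.2 : C)
    rad := fun t => (bs t.1 t.2).2.1
    src := fun t => (bs t.1 t.2).2.2
    expand := ?_
    dual := fun t => ((bs t.1).coord t.2).comp (g t.1)
    dual_self := ?_
    dual_ne := ?_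
    dual_e := ?_ }⟩
  · intro x hx
    have hxp : ∀ p, x * d.e p ∈ R p := fun p =>
      ⟨(hd.mul_rad hx _).1, by rw [mul_assoc, d.e_self]⟩
    refine ⟨fun t => (bs t.1).repr ⟨_, hxp t.1⟩ t.2, ?_⟩
    rw [Fintype.sum_sigma]
    conv_lhs => rw [← d.sum_mul_e x]
    refine Finset.sum_congr rfl fun p _ => ?_
    have := (bs p).sum_repr ⟨_, hxp p⟩
    have := congrArg (Subtype.val) this
    simp only [AddSubmonoidClass.coe_finsetSum, Submodule.coe_smul] at this
    exact this.symm
  · rintro ⟨p, x⟩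
    have : g p (bs p x : C) = bs p x := by
      apply Subtype.ext
      show f p _ = _
      rw [hfr p _ (bs p x).2.1]; exact (bs p x).2.2
    simp [this]
  · rintro ⟨p, x⟩ ⟨q, y⟩ h
    by_cases hpq : p = q
    · subst hpq
      have : g p (bs p y : C) = bs p y := by
        apply Subtype.ext
        show f p _ = _
        rw [hfr p _ (bs p y).2.1]; exact (bs p y).2.2
      have hxy : y ≠ x := fun h' => h (by rw [h'])
      simp [this, hxy]
    · have : g p (bs q y : C) = 0 := by
        apply Subtype.ext
        show f p _ = _
        rw [hfr p _ (bs q y).2.1, ← (bs q y).2.2, mul_assoc, d.e_ne (Ne.symm hpq), mul_zero]; rfl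
      simp [this]
  · rintro ⟨p, x⟩ q
    have : g p (d.e q) = 0 := Subtype.ext (hfe p q)
    simp [this]

section ext

variable {K : Type} [Field K] {n : ℕ} {B C L : Type} [Ring B] [Algebra K B]
  [Ring C] [Algebra K C] [Ring L] [Algebra K L] {dB : IdemData K n B} {dC : IdemData K n C}
  (D : DualExt K n B C L dB dC) (hB : dB.Directed) (hC : dC.Codirected) (T : RadBasis dC)

include hB hC in
/-- Left multiples of radical elements of `C` are radical elements of `C`. -/
lemma mul_radC (l : L) (c : C) (hc : dC.IsRad c) :
    ∃ c', dC.IsRad c' ∧ l * D.ιC c = D.ιC c' := by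
  have hl : l ∈ Submodule.span K {x : L | ∃ c b, x = D.ιC c * D.ιB b} := by
    rw [D.spans]; trivial
  induction hl using Submodule.span_induction with
  | mem x hx =>
    obtain ⟨c₁, b, rfl⟩ := hx
    obtain ⟨κ, hκ⟩ := IdemData.diag_of hB.2.2 b
    refine ⟨c₁ * ((∑ p, κ p • dC.e p) * c), (hC.mul_rad (hC.mul_rad hc _).2 _).2, ?_⟩
    have h1 := D.radMul _ c hκ hc
    rw [map_sub, sub_mul, sub_eq_zero] at h1
    rw [mul_assoc, h1]
    simp only [map_mul, map_sum, map_smul, D.idem]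
  | zero => exact ⟨0, dC.isRad_zero, by simp⟩
  | add x y _ _ hx hy =>
    obtain ⟨c₁, h₁, e₁⟩ := hx
    obtain ⟨c₂, h₂, e₂⟩ := hy
    exact ⟨c₁ + c₂, dC.isRad_add h₁ h₂, by rw [add_mul, e₁, e₂, map_add]⟩
  | smul k x _ hx =>
    obtain ⟨c₁, h₁, e₁⟩ := hx
    exact ⟨k • c₁, dC.isRad_smul k h₁, by rw [smul_mul_assoc, e₁, map_smul]⟩

include hC in
lemma expandC (c : C) : ∃ (κ : Fin n → K) (μ : T.T → K),
    c = ∑ p, κ p • dC.e p + ∑ t, μ t • T.c t := by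
  obtain ⟨κ, hκ⟩ := IdemData.diag_of hC.2.2 c
  obtain ⟨μ, hμ⟩ := T.expand _ hκ
  exact ⟨κ, μ, by rw [← hμ]; abel⟩

include hC in
lemma decomp (l : L) : ∃ (b : B) (f : T.T → B), l = D.ιB b + ∑ t, D.ιC (T.c t) * D.ιB (f t) := by
  have hl : l ∈ Submodule.span K {x : L | ∃ c b, x = D.ιC c * D.ιB b} := by
    rw [D.spans]; trivial
  induction hl using Submodule.span_induction with
  | mem x hx =>
    obtain ⟨c, b, rfl⟩ := hx
    obtain ⟨κ, μ, rfl⟩ := expandC hC T c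
    refine ⟨(∑ p, κ p • dB.e p) * b, fun t => μ t • b, ?_⟩
    simp only [map_add, map_sum, map_smul, map_mul, D.idem, add_mul, Finset.sum_mul,
      smul_mul_assoc, mul_smul_comm]
  | zero => exact ⟨0, 0, by simp⟩
  | add x y _ _ hx hy =>
    obtain ⟨b₁, f₁, e₁⟩ := hx
    obtain ⟨b₂, f₂, e₂⟩ := hy
    refine ⟨b₁ + b₂, f₁ + f₂, ?_⟩
    rw [e₁, e₂]
    simp only [map_add, Pi.add_apply, mul_add, Finset.sum_add_distrib]
    abel
  | smul k x _ hx =>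
    obtain ⟨b₁, f₁, e₁⟩ := hx
    refine ⟨k • b₁, k • f₁, ?_⟩
    rw [e₁]
    simp only [map_smul, Pi.smul_apply, mul_smul_comm, smul_add, Finset.smul_sum]

lemma src_ι (t : T.T) : D.ιC (T.c t) * D.ιB (dB.e (T.s t)) = D.ιC (T.c t) := by
  rw [D.idem, ← map_mul, T.src]

lemma uniq (b : B) (f : T.T → B) (hf : ∀ t, dB.e (T.s t) * f t = f t)
    (h : D.ιB b + ∑ t, D.ιC (T.c t) * D.ιB (f t) = 0) : b = 0 ∧ ∀ t, f t = 0 := by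
  classical
  suffices hft : ∀ t, f t = 0 by
    refine ⟨D.injB ?_, hft⟩
    simpa [hft] using h
  intro t
  let x : TensorProduct K C B := 1 ⊗ₜ[K] b + ∑ t, T.c t ⊗ₜ[K] f t
  have hx : x ∈ LinearMap.ker (TensorProduct.lift (dualBil D.ιB D.ιC)) := by
    rw [LinearMap.mem_ker]
    simpa [x, dualBil] using h
  rw [D.mulKer] at hx
  let Ψ : TensorProduct K C B →ₗ[K] B := TensorProduct.lift
    (LinearMap.mk₂ K (fun c b => ∑ p, T.dual t (c * dC.e p) • (dB.e p * b))
      (fun c c' b => by simp only [add_mul, map_add, add_smul, Finset.sum_add_distrib])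
      (fun k c b => by simp only [smul_mul_assoc, map_smul, Finset.smul_sum, smul_smul, smul_eq_mul])
      (fun c b b' => by simp only [mul_add, smul_add, Finset.sum_add_distrib])
      (fun k c b => by
        simp only [mul_smul_comm, Finset.smul_sum]
        exact Finset.sum_congr rfl fun p _ => smul_comm _ _ _))
  have hΨ : Ψ x = 0 := by
    have : Submodule.span K {x : TensorProduct K C B |
      ∃ i j : Fin n, i ≠ j ∧ ∃ c b, x = (c * dC.e i) ⊗ₜ[K] (dB.e j * b)} ≤ LinearMap.ker Ψ := by
      rw [Submodule.span_le]
      rintro _ ⟨i, j, hij, c, b, rfl⟩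
      show Ψ _ = 0
      simp only [Ψ, TensorProduct.lift.tmul, LinearMap.mk₂_apply]
      refine Finset.sum_eq_zero fun p _ => ?_
      by_cases hp : i = p
      · subst hp
        rw [← mul_assoc (dB.e i), dB.e_ne hij, zero_mul, smul_zero]
      · rw [mul_assoc, dC.e_ne hp, mul_zero, map_zero, zero_smul]
    exact this hx
  have h2 : Ψ x = f t := by
    simp only [x, map_add, map_sum, Ψ, TensorProduct.lift.tmul, LinearMap.mk₂_apply]
    have h3 : ∀ t', ∑ p, T.dual t (T.c t' * dC.e p) • (dB.e p * f t') = T.dual t (T.c t') • f t' := by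
      intro t'
      rw [Finset.sum_eq_single (T.s t')]
      · rw [T.src, hf]
      · intro p _ hp
        rw [← T.src t', mul_assoc, dC.e_ne hp.symm]; simp
      · simp
    simp only [h3, one_mul, T.dual_e, zero_smul, Finset.sum_const_zero, zero_add]
    rw [Finset.sum_eq_single t]
    · rw [T.dual_self, one_smul]
    · intro t' _ ht'
      rw [T.dual_ne t t' ht'.symm, zero_smul]
    · simp
  rw [← h2, hΨ]

end ext
section forms

variable {K : Type} [Field K] {n : ℕ} {B C L : Type} [Ring B] [Algebra K B]
  [Ring C] [Algebra K C] [Ring L] [Algebra K L] {dB : IdemData K n B} {dC : IdemData K n C}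
  (D : DualExt K n B C L dB dC) (T : RadBasis dC)
  {M : Type} [AddCommGroup M] [Module L M]

def BStable (Z : AddSubgroup M) : Prop := ∀ b, ∀ z ∈ Z, D.ιB b • z ∈ Z

def SC (Z : AddSubgroup M) : AddSubgroup M where
  carrier := {x | ∃ z : T.T → M, (∀ t, z t ∈ Z) ∧ x = ∑ t, D.ιC (T.c t) • z t}
  add_mem' := by
    rintro _ _ ⟨z, hz, rfl⟩ ⟨w, hw, rfl⟩
    exact ⟨fun t => z t + w t, fun t => Z.add_mem (hz t) (hw t), by
      simp only [smul_add, Finset.sum_add_distrib]⟩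
  zero_mem' := ⟨fun _ => 0, fun _ => Z.zero_mem, by simp⟩
  neg_mem' := by
    rintro _ ⟨z, hz, rfl⟩
    exact ⟨fun t => - z t, fun t => Z.neg_mem (hz t), by
      simp only [smul_neg, Finset.sum_neg_distrib]⟩

/-- `Z` is a `B`-form of the `L`-submodule it generates. -/
def BFree (Z : AddSubgroup M) : Prop :=
  BStable D Z ∧ ∀ z₀ ∈ Z, ∀ z : T.T → M, (∀ t, z t ∈ Z) →
    (∀ t, D.ιB (dB.e (T.s t)) • z t = z t) → z₀ + ∑ t, D.ιC (T.c t) • z t = 0 →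
    z₀ = 0 ∧ ∀ t, z t = 0

variable {D T}

lemma SC_mono {Z W : AddSubgroup M} (h : Z ≤ W) : SC D T Z ≤ SC D T W := by
  rintro _ ⟨z, hz, rfl⟩
  exact ⟨z, fun t => h (hz t), rfl⟩

lemma SC_norm {Z : AddSubgroup M} (hZ : BStable D Z) {x : M} (hx : x ∈ SC D T Z) :
    ∃ z : T.T → M, (∀ t, z t ∈ Z) ∧ (∀ t, D.ιB (dB.e (T.s t)) • z t = z t) ∧
      x = ∑ t, D.ιC (T.c t) • z t := by
  obtain ⟨z, hz, rfl⟩ := hx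
  refine ⟨fun t => D.ιB (dB.e (T.s t)) • z t, fun t => hZ _ _ (hz t), fun t => ?_, ?_⟩
  · rw [← mul_smul, ← map_mul, dB.e_self]
  · refine Finset.sum_congr rfl fun t _ => ?_
    rw [← mul_smul, src_ι]

lemma radC_smul_mem {Z : AddSubgroup M} (hZ : BStable D Z) {c : C} (hc : dC.IsRad c) {z : M}
    (hz : z ∈ Z) : D.ιC c • z ∈ SC D T Z := by
  obtain ⟨κ, rfl⟩ := T.expand c hc
  refine ⟨fun t => D.ιB (algebraMap K B (κ t)) • z, fun t => hZ _ _ hz, ?_⟩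
  rw [map_sum, Finset.sum_smul]
  refine Finset.sum_congr rfl fun t _ => ?_
  rw [← mul_smul, AlgHom.commutes, map_smul, ← Algebra.commutes, Algebra.smul_def]

lemma smul_SC (hB : dB.Directed) (hC : dC.Codirected) {Z : AddSubgroup M} (hZ : BStable D Z)
    (l : L) {x : M} (hx : x ∈ SC D T Z) : l • x ∈ SC D T Z := by
  obtain ⟨z, hz, rfl⟩ := hx
  rw [Finset.smul_sum]
  refine AddSubgroup.sum_mem _ fun t _ => ?_
  obtain ⟨c', hc', h⟩ := mul_radC D hB hC l (T.c t) (T.rad t)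
  rw [← mul_smul, h]
  exact radC_smul_mem hZ hc' (hz t)

lemma smul_mem_sup (hC : dC.Codirected) {Z : AddSubgroup M} (hZ : BStable D Z)
    (l : L) {x : M} (hx : x ∈ Z) : l • x ∈ Z ⊔ SC D T Z := by
  obtain ⟨b, f, rfl⟩ := decomp D hC T l
  rw [add_smul, Finset.sum_smul]
  refine AddSubgroup.mem_sup.2 ⟨_, hZ b _ hx, _, ⟨fun t => D.ιB (f t) • x,
    fun t => hZ _ _ hx, rfl⟩, ?_⟩
  simp only [mul_smul]

lemma span_mem (hB : dB.Directed) (hC : dC.Codirected) {Z : AddSubgroup M} (hZ : BStable D Z)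
    {x : M} (hx : x ∈ Submodule.span L (Z : Set M)) : x ∈ Z ⊔ SC D T Z := by
  induction hx using Submodule.span_induction with
  | mem x hx => exact AddSubgroup.mem_sup_left hx
  | zero => exact AddSubgroup.zero_mem _
  | add x y _ _ hx hy => exact AddSubgroup.add_mem _ hx hy
  | smul l x _ hx =>
    obtain ⟨z, hz, w, hw, rfl⟩ := AddSubgroup.mem_sup.1 hx
    rw [smul_add]
    exact AddSubgroup.add_mem _ (smul_mem_sup hC hZ l hz)
      (AddSubgroup.mem_sup_right (smul_SC hB hC hZ l hw))

lemma span_decomp (hB : dB.Directed) (hC : dC.Codirected) {Z : AddSubgroup M} (hZ : BStable D Z)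
    {x : M} (hx : x ∈ Submodule.span L (Z : Set M)) :
    ∃ z₀ ∈ Z, ∃ z : T.T → M, (∀ t, z t ∈ Z) ∧ (∀ t, D.ιB (dB.e (T.s t)) • z t = z t) ∧
      x = z₀ + ∑ t, D.ιC (T.c t) • z t := by
  obtain ⟨z, hz, w, hw, rfl⟩ := AddSubgroup.mem_sup.1 (span_mem (T := T) hB hC hZ hx)
  obtain ⟨f, h1, h2, rfl⟩ := SC_norm hZ hw
  exact ⟨z, hz, f, h1, h2, rfl⟩

/-- Radical elements of `L` have radical `B`-part. -/
lemma rad_decomp (hB : dB.Directed) (hC : dC.Codirected) {dL : IdemData K n L}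
    (hdL : ∀ i, dL.e i = D.ιB (dB.e i)) {l : L} (hl : dL.IsRad l) :
    ∃ (b : B) (f : T.T → B), dB.IsRad b ∧ l = D.ιB b + ∑ t, D.ιC (T.c t) * D.ιB (f t) := by
  obtain ⟨b, f, rfl⟩ := decomp D hC T l
  refine ⟨b, f, fun p => ?_, rfl⟩
  have h := hl p
  have hst : BStable D (M := L) D.ιB.toRingHom.range.toAddSubgroup := by
    rintro b _ ⟨b', rfl⟩
    exact ⟨b * b', by simp⟩
  have h2 : (dL.e p * ∑ t, D.ιC (T.c t) * D.ιB (f t)) * dL.e p ∈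
      SC D T (D.ιB.toRingHom.range.toAddSubgroup : AddSubgroup L) := by
    rw [mul_assoc, Finset.sum_mul]
    refine smul_SC hB hC hst (dL.e p) ⟨fun t => D.ιB (f t * dB.e p), fun t => ⟨_, rfl⟩, ?_⟩
    refine Finset.sum_congr rfl fun t _ => ?_
    simp only [map_mul, hdL, smul_eq_mul, mul_assoc]
  obtain ⟨z, h3, h4, h5⟩ := SC_norm hst h2
  choose g hg using h3
  rw [mul_add, add_mul, h5] at h
  have h6 := uniq D T (dB.e p * b * dB.e p) (fun t => dB.e (T.s t) * g t)
    (fun t => by rw [← mul_assoc, dB.e_self]) (by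
      rw [← h, map_mul, map_mul, hdL]
      congr 1
      refine Finset.sum_congr rfl fun t _ => ?_
      rw [← h4 t, ← hg t, map_mul]; rfl)
  exact h6.1

/-- Coordinates on a direct sum of modules `L e_v`. -/
structure Coord {K : Type} [Field K] {n : ℕ} {L : Type} [Ring L] [Algebra K L]
    (dL : IdemData K n L) (ι : Type) [Fintype ι] (v : ι → Fin n)
    (M : Type) [AddCommGroup M] [Module L M] where
  a : ι → M →ₗ[L] L
  g : ι → M
  a_e : ∀ i q, a i q * dL.e (v i) = a i q
  sum_a : ∀ q, ∑ i, a i q • g i = q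
  a_g : ∀ i, a i (g i) = dL.e (v i)
  a_g_ne : ∀ i k, i ≠ k → a i (g k) = 0

lemma Coord.e_g {dL : IdemData K n L} {ι : Type} [Fintype ι] {v : ι → Fin n}
    (Y : Coord dL ι v M) (i : ι) : dL.e (v i) • Y.g i = Y.g i := by
  conv_rhs => rw [← Y.sum_a (Y.g i)]
  rw [Finset.sum_eq_single i]
  · rw [Y.a_g]
  · intro k _ hk
    rw [Y.a_g_ne k i hk, zero_smul]
  · simp

def coordOf {dL : IdemData K n L} (m : Fin n → ℕ)
    (E : M ≃ₗ[L] ∀ ℓ : Fin n, Fin (m ℓ) → ↥(leftIdeal (dL.e ℓ))) :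
    Coord dL (Σ ℓ, Fin (m ℓ)) (fun x => x.1) M where
  a := fun x => (leftIdeal (dL.e x.1)).subtype ∘ₗ LinearMap.proj x.2 ∘ₗ LinearMap.proj x.1 ∘ₗ
    E.toLinearMap
  g := fun x => E.symm (Pi.single x.1 (Pi.single x.2 ⟨dL.e x.1, dL.e_self _⟩))
  a_e := fun x q => (E q x.1 x.2).2
  a_g := by
    rintro ⟨ℓ, s⟩
    simp
  a_g_ne := by
    rintro ⟨ℓ, s⟩ ⟨ℓ', s'⟩ h
    by_cases hl : ℓ = ℓ'
    · subst hl
      have : s ≠ s' := fun h' => h (by rw [h'])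
      simp [this]
    · simp [Pi.single_eq_of_ne hl]
  sum_a := by
    intro q
    apply E.injective
    rw [map_sum, Fintype.sum_sigma]
    funext ℓ s
    simp only [map_smul, LinearEquiv.apply_symm_apply, Finset.sum_apply, Pi.smul_apply]
    rw [Finset.sum_eq_single ℓ, Finset.sum_eq_single s]
    · simp only [Pi.single_eq_same]
      exact Subtype.ext (E q ℓ s).2
    · intro s' _ hs
      simp [Pi.single_eq_of_ne hs.symm]
    · simp
    · intro ℓ' _ hl
      refine Finset.sum_eq_zero fun s' _ => ?_
      simp [Pi.single_eq_of_ne hl.symm]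
    · simp

section filt

/-- Filtration of `C` by path length. -/
def Filt (dC : IdemData K n C) (k : ℕ) (c : C) : Prop :=
  ∀ p q : Fin n, q.val < p.val + k → dC.e p * c * dC.e q = 0

lemma filt_one (hC : dC.Codirected) {c : C} (hc : dC.IsRad c) : Filt dC 1 c := by
  intro p q h
  rcases eq_or_ne p q with rfl | hne
  · exact hc p
  · refine hC.2.1 q p ?_ c
    have : p.val ≠ q.val := fun h => hne (Fin.ext h)
    rw [Fin.lt_def]; omega

lemma filt_mul {k : ℕ} {c c' : C} (hc : Filt dC k c) (hc' : Filt dC 1 c') :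
    Filt dC (k + 1) (c * c') := by
  intro p q h
  rw [show dC.e p * (c * c') * dC.e q = dC.e p * c * (c' * dC.e q) by noncomm_ring,
    ← dC.mul_split]
  refine Finset.sum_eq_zero fun r _ => ?_
  by_cases hr : r.val < p.val + k
  · rw [hc p r hr, zero_mul]
  · rw [← mul_assoc (dC.e r), hc' r q (by omega), mul_zero]

lemma filt_top {c : C} (hc : Filt dC n c) : c = 0 := by
  have h : ∀ p, dC.e p * c = 0 := fun p => by
    rw [← dC.sum_mul_e (dC.e p * c)]
    exact Finset.sum_eq_zero fun q _ => hc p q (by omega)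
  rw [← dC.sum_e_mul c]
  exact Finset.sum_eq_zero fun p _ => h p

lemma eta_nilp (hC : dC.Codirected) (η : M →ₗ[L] M) (h : ∀ q, η q ∈ SC D T (⊤ : AddSubgroup M)) :
    IsNilpotent η := by
  have key : ∀ k q, (η ^ (k + 1)) q ∈
      AddSubgroup.closure {x : M | ∃ c q, Filt dC (k + 1) c ∧ x = D.ιC c • q} := by
    intro k
    induction k with
    | zero =>
      intro q
      obtain ⟨z, -, hz⟩ := h q
      rw [zero_add, pow_one, hz]
      exact AddSubgroup.sum_mem _ fun t _ => AddSubgroup.subset_closure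
        ⟨_, _, filt_one hC (T.rad t), rfl⟩
    | succ k ih =>
      intro q
      rw [pow_succ', Module.End.mul_apply]
      have := ih q
      generalize (η ^ (k + 1)) q = y at this
      induction this using AddSubgroup.closure_induction with
      | mem x hx =>
        obtain ⟨c, q, hc, rfl⟩ := hx
        obtain ⟨z, -, hz⟩ := h q
        rw [map_smul, hz, Finset.smul_sum]
        refine AddSubgroup.sum_mem _ fun t _ => AddSubgroup.subset_closure
          ⟨_, z t, filt_mul hc (filt_one hC (T.rad t)), ?_⟩
        rw [← mul_smul, map_mul]
      | zero => rw [map_zero]; exact AddSubgroup.zero_mem _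
      | add x y _ _ hx hy => rw [map_add]; exact AddSubgroup.add_mem _ hx hy
      | neg x _ hx => rw [map_neg]; exact AddSubgroup.neg_mem _ hx
  refine ⟨n + 1, LinearMap.ext fun q => ?_⟩
  have := key n q
  rw [AddSubgroup.closure_eq_bot_iff.2] at this
  · exact this
  · rintro _ ⟨c, q, hc, rfl⟩
    have : Filt dC n c := fun p q h => hc p q (by omega)
    rw [filt_top this]; simp

end filt

/-- The key step: kernels of projective covers of modules with a `B`-form have a `B`-form,
inside `rad B` times the cover. -/
lemma key_step (hB : dB.Directed) (hC : dC.Codirected) {dL : IdemData K n L}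
    (hdL : ∀ i, dL.e i = D.ιB (dB.e i)) {ι : Type} [Fintype ι] {v : ι → Fin n}
    {Q : Type} [AddCommGroup Q] [Module L Q]
    (Y : Coord dL ι v Q) (π : Q →ₗ[L] M) (X : AddSubgroup M) (hX : BFree D T X)
    (hr : LinearMap.range π = Submodule.span L (X : Set M))
    (hmin : LinearMap.ker π ≤ Submodule.span L {x : Q | ∃ b m, dL.IsRad b ∧ x = b • m}) :
    (∃ Z : AddSubgroup Q, BFree D T Z ∧ LinearMap.ker π = Submodule.span L (Z : Set Q)) ∧
    LinearMap.ker π ≤ Submodule.span L {x : Q | ∃ b y, dB.IsRad b ∧ x = D.ιB b • y} := by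
  classical
  -- corrected generators
  have hg : ∀ i, ∃ g' : Q, π g' ∈ X ∧ Y.g i - g' ∈ SC D T (⊤ : AddSubgroup Q) ∧
      dL.e (v i) • g' = g' := by
    intro i
    have h1 : π (Y.g i) ∈ Submodule.span L (X : Set M) := hr ▸ LinearMap.mem_range_self π _
    obtain ⟨x₀, hx₀, x, hx, -, he⟩ := span_decomp (T := T) hB hC hX.1 h1
    have h2 : ∀ t, ∃ q, π q = x t := fun t => by
      have : x t ∈ LinearMap.range π := hr ▸ Submodule.subset_span (hx t)
      exact this
    choose q hq using h2
    refine ⟨dL.e (v i) • (Y.g i - ∑ t, D.ιC (T.c t) • q t), ?_, ?_, ?_⟩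
    · have : π (Y.g i - ∑ t, D.ιC (T.c t) • q t) = x₀ := by
        simp only [map_sub, map_sum, map_smul, hq, he]; abel
      rw [map_smul, this, hdL]
      exact hX.1 _ _ hx₀
    · rw [smul_sub, Y.e_g, sub_sub_cancel]
      exact smul_SC hB hC (Z := ⊤) (fun _ _ _ => AddSubgroup.mem_top _) _ ⟨q, fun _ => AddSubgroup.mem_top _, rfl⟩
    · rw [← mul_smul, dL.e_self]
  choose g' hg1 hg2 hg3 using hg
  let θ : Q →ₗ[L] Q := ∑ i, (Y.a i).smulRight (g' i)
  have hθ : ∀ q, θ q = ∑ i, Y.a i q • g' i := fun q => by simp [θ]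
  have hnil : IsNilpotent (1 - θ : Module.End L Q) := by
    refine eta_nilp (D := D) (T := T) hC _ fun q => ?_
    rw [LinearMap.sub_apply, Module.End.one_apply, hθ]
    conv => enter [2, 1]; rw [← Y.sum_a q]
    rw [← Finset.sum_sub_distrib]
    refine AddSubgroup.sum_mem _ fun i _ => ?_
    rw [← smul_sub]
    exact smul_SC hB hC (Z := ⊤) (fun _ _ _ => AddSubgroup.mem_top _) _ (hg2 i)
  have hunit : IsUnit (θ : Module.End L Q) := by
    have := hnil.isUnit_one_sub
    rwa [sub_sub_cancel] at this
  have hbij : Function.Bijective θ := (Module.End.isUnit_iff θ).1 hunit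
  -- standard form
  let W : AddSubgroup Q :=
    { carrier := {q | ∀ i, ∃ b, Y.a i q = D.ιB b}
      add_mem' := fun {x y} hx hy i => by
        obtain ⟨b, hb⟩ := hx i
        obtain ⟨b', hb'⟩ := hy i
        exact ⟨b + b', by rw [map_add, hb, hb', map_add]⟩
      zero_mem' := fun i => ⟨0, by simp⟩
      neg_mem' := fun {x} hx i => by
        obtain ⟨b, hb⟩ := hx i
        exact ⟨-b, by rw [map_neg, hb, map_neg]⟩ }
  have hWs : BStable D W := fun b z hz i => by
    obtain ⟨b', hb'⟩ := hz i
    exact ⟨b * b', by rw [map_smul, hb', smul_eq_mul, map_mul]⟩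
  have hgW : ∀ i, Y.g i ∈ W := fun i k => by
    by_cases h : k = i
    · subst h; exact ⟨_, by rw [Y.a_g, hdL]⟩
    · exact ⟨0, by rw [Y.a_g_ne k i h, map_zero]⟩
  have hWf : BFree D T W := by
    refine ⟨hWs, fun z₀ hz₀ z hz hze h => ?_⟩
    choose b₀ hb₀ using hz₀
    choose b hb using hz
    have h2 : ∀ i, b₀ i = 0 ∧ ∀ t, dB.e (T.s t) * b t i = 0 := fun i => by
      refine uniq D T (b₀ i) (fun t => dB.e (T.s t) * b t i)
        (fun t => by rw [← mul_assoc, dB.e_self]) ?_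
      have := congrArg (Y.a i) h
      rw [map_add, map_sum, map_zero, hb₀] at this
      rw [← this]
      congr 1
      refine Finset.sum_congr rfl fun t _ => ?_
      rw [map_smul, hb, map_mul, ← mul_assoc, src_ι, smul_eq_mul]
    constructor
    · rw [← Y.sum_a z₀]
      exact Finset.sum_eq_zero fun i _ => by rw [hb₀, (h2 i).1]; simp
    · intro t
      rw [← hze t, ← Y.sum_a (z t), Finset.smul_sum]
      exact Finset.sum_eq_zero fun i _ => by
        rw [hb, ← mul_smul, ← map_mul, (h2 i).2]; simp
  -- twisted form
  let V : AddSubgroup Q := W.map θ.toAddMonoidHom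
  have hVs : BStable D V := by
    rintro b _ ⟨w, hw, rfl⟩
    exact ⟨D.ιB b • w, hWs _ _ hw, map_smul θ _ _⟩
  have hVf : BFree D T V := by
    refine ⟨hVs, fun z₀ hz₀ z hz hze h => ?_⟩
    obtain ⟨w₀, hw₀, rfl⟩ := hz₀
    choose w hw hwz using hz
    have hwz' : ∀ t, θ (w t) = z t := hwz
    have := hWf.2 w₀ hw₀ w hw (fun t => hbij.1 (by rw [map_smul, hwz', hze])) (hbij.1 (by
      rw [map_add, map_sum, map_zero, ← h]
      simp only [map_smul, hwz']
      rfl))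
    refine ⟨by rw [this.1, map_zero], fun t => by rw [← hwz', this.2, map_zero]⟩
  have hVtop : ∀ q, q ∈ Submodule.span L (V : Set Q) := by
    intro q
    obtain ⟨q, rfl⟩ := hbij.2 q
    rw [← Y.sum_a q, map_sum]
    refine Submodule.sum_mem _ fun i _ => ?_
    rw [map_smul]
    exact Submodule.smul_mem _ _ (Submodule.subset_span ⟨_, hgW i, rfl⟩)
  have hVX : ∀ y ∈ V, π y ∈ X := by
    rintro _ ⟨w, hw, rfl⟩
    show π (θ w) ∈ X
    rw [hθ, map_sum]
    refine AddSubgroup.sum_mem _ fun i _ => ?_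
    obtain ⟨b, hb⟩ := hw i
    rw [map_smul, hb]
    exact hX.1 _ _ (hg1 i)
  let Z : AddSubgroup Q := V ⊓ (LinearMap.ker π).toAddSubgroup
  have hZs : BStable D Z := fun b z hz => ⟨hVs _ _ hz.1, (LinearMap.ker π).smul_mem _ hz.2⟩
  have hZker : LinearMap.ker π = Submodule.span L (Z : Set Q) := by
    apply le_antisymm
    · intro q hq
      obtain ⟨y₀, hy₀, y, hy, hye, rfl⟩ := span_decomp (T := T) hB hC hVs (hVtop q)
      have h := LinearMap.mem_ker.1 hq
      rw [map_add, map_sum] at h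
      simp only [map_smul] at h
      obtain ⟨h1, h2⟩ := hX.2 _ (hVX _ hy₀) (fun t => π (y t)) (fun t => hVX _ (hy t))
        (fun t => by rw [← map_smul, hye]) h
      refine Submodule.add_mem _ (Submodule.subset_span ⟨hy₀, h1⟩)
        (Submodule.sum_mem _ fun t _ => Submodule.smul_mem _ _
          (Submodule.subset_span ⟨hy t, h2 t⟩))
    · rw [Submodule.span_le]
      exact fun z hz => hz.2
  refine ⟨⟨Z, ⟨hZs, fun z₀ hz₀ z hz => hVf.2 z₀ hz₀.1 z fun t => (hz t).1⟩, hZker⟩, ?_⟩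
  -- radical part
  let R₀ : AddSubgroup Q := AddSubgroup.closure {x | ∃ b y, dB.IsRad b ∧ y ∈ V ∧ x = D.ιB b • y}
  have hR₀V : R₀ ≤ V := by
    rw [AddSubgroup.closure_le]
    rintro _ ⟨b, y, -, hy, rfl⟩
    exact hVs _ _ hy
  have hR₀s : BStable D R₀ := by
    intro b z hz
    induction hz using AddSubgroup.closure_induction with
    | mem x hx =>
      obtain ⟨b', y, hb', hy, rfl⟩ := hx
      exact AddSubgroup.subset_closure ⟨b * b', y, (hB.mul_rad hb' b).2, hy, by
        rw [← mul_smul, map_mul]⟩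
    | zero => rw [smul_zero]; exact AddSubgroup.zero_mem _
    | add x y _ _ hx hy => rw [smul_add]; exact AddSubgroup.add_mem _ hx hy
    | neg x _ hx => rw [smul_neg]; exact AddSubgroup.neg_mem _ hx
  have hRad : ∀ q ∈ Submodule.span L {x : Q | ∃ b m, dL.IsRad b ∧ x = b • m},
      q ∈ R₀ ⊔ SC D T V := by
    intro q hq
    induction hq using Submodule.span_induction with
    | mem x hx =>
      obtain ⟨l, m, hl, rfl⟩ := hx
      obtain ⟨y, hy, w, hw, rfl⟩ := AddSubgroup.mem_sup.1 (span_mem (T := T) hB hC hVs (hVtop m))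
      rw [smul_add]
      refine AddSubgroup.add_mem _ ?_ (AddSubgroup.mem_sup_right (smul_SC hB hC hVs _ hw))
      obtain ⟨b, f, hb, rfl⟩ := rad_decomp (D := D) (T := T) hB hC hdL hl
      rw [add_smul, Finset.sum_smul]
      refine AddSubgroup.add_mem _
        (AddSubgroup.mem_sup_left (AddSubgroup.subset_closure ⟨b, y, hb, hy, rfl⟩))
        (AddSubgroup.mem_sup_right ⟨fun t => D.ιB (f t) • y, fun t => hVs _ _ hy, ?_⟩)
      simp only [mul_smul]
    | zero => exact AddSubgroup.zero_mem _
    | add x y _ _ hx hy => exact AddSubgroup.add_mem _ hx hy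
    | smul l x _ hx =>
      obtain ⟨z, hz, w, hw, rfl⟩ := AddSubgroup.mem_sup.1 hx
      rw [smul_add]
      refine AddSubgroup.add_mem _ ?_ (AddSubgroup.mem_sup_right (smul_SC hB hC hVs l hw))
      exact sup_le_sup_left (SC_mono hR₀V) _ (smul_mem_sup hC hR₀s l hz)
  have hZR : (Z : Set Q) ⊆ R₀ := by
    intro y hy
    obtain ⟨z, hz, w, hw, h⟩ := AddSubgroup.mem_sup.1 (hRad y (hmin hy.2))
    obtain ⟨f, hf1, hf2, rfl⟩ := SC_norm hVs hw
    have := (hVf.2 (z - y) (V.sub_mem (hR₀V hz) hy.1) f hf1 hf2 (by rw [← h]; abel)).1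
    rw [sub_eq_zero] at this
    rw [← this]; exact hz
  rw [hZker, Submodule.span_le]
  refine hZR.trans ?_
  have : R₀ ≤ (Submodule.span L {x : Q | ∃ b y, dB.IsRad b ∧ x = D.ιB b • y}).toAddSubgroup := by
    rw [AddSubgroup.closure_le]
    rintro _ ⟨b, y, hb, -, rfl⟩
    exact Submodule.subset_span ⟨b, y, hb, rfl⟩
  exact this

end forms
section stdmod

variable {K : Type} [Field K] {n : ℕ} {B C L : Type} [Ring B] [Algebra K B]
  [Ring C] [Algebra K C] [Ring L] [Algebra K L] {dB : IdemData K n B} {dC : IdemData K n C}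
  (D : DualExt K n B C L dB dC) (T : RadBasis dC)

lemma exists_stdMk (i : Fin n) : ∃ f : L →ₗ[L] D.std i, Function.Surjective f ∧
    ∀ l, f l = 0 ↔ l * D.ιB (dB.e i) ∈
      Submodule.span L {x : L | ∃ b, dB.IsRad b ∧ x = D.ιB b * D.ιB (dB.e i)} := by
  have hee : D.ιB (dB.e i) * D.ιB (dB.e i) = D.ιB (dB.e i) := by rw [← map_mul, dB.e_self]
  let N := (Submodule.span L {x : L | ∃ b, dB.IsRad b ∧ x = D.ιB b * D.ιB (dB.e i)}).comap
      (leftIdeal (D.ιB (dB.e i))).subtype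
  let g : L →ₗ[L] ↥(leftIdeal (D.ιB (dB.e i))) :=
    LinearMap.toSpanSingleton L _ ⟨D.ιB (dB.e i), hee⟩
  let f : L →ₗ[L] (↥(leftIdeal (D.ιB (dB.e i))) ⧸ N) := N.mkQ ∘ₗ g
  have hf : Function.Surjective f := by
    intro x
    obtain ⟨⟨y, hy⟩, rfl⟩ := N.mkQ_surjective x
    refine ⟨y, ?_⟩
    show N.mkQ _ = _
    congr 1
    exact Subtype.ext hy
  refine ⟨f, hf, fun l => ?_⟩
  exact Submodule.Quotient.mk_eq_zero N

section

variable {D T} (hB : dB.Directed) (hC : dC.Codirected)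
  {i : Fin n} {f : L →ₗ[L] D.std i}
  (hf : ∀ l, f l = 0 ↔ l * D.ιB (dB.e i) ∈
      Submodule.span L {x : L | ∃ b, dB.IsRad b ∧ x = D.ιB b * D.ιB (dB.e i)})

include hf

lemma stdMk_rad {b : B} (hb : dB.IsRad (b * dB.e i)) : f (D.ιB b) = 0 := by
  rw [hf]
  refine Submodule.subset_span ⟨_, hb, ?_⟩
  rw [← map_mul, ← map_mul, mul_assoc, dB.e_self]

lemma stdMk_e (l : L) : f (l * D.ιB (dB.e i)) = f l := by
  rw [← sub_eq_zero, ← map_sub, hf, sub_mul, mul_assoc, ← map_mul, dB.e_self, sub_self]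
  exact Submodule.zero_mem _

include hB hC

lemma stdMk_uniq (b : B) (g : T.T → B) (hg : ∀ t, dB.e (T.s t) * g t = g t)
    (h : f (D.ιB b + ∑ t, D.ιC (T.c t) * D.ιB (g t)) = 0) :
    dB.IsRad (b * dB.e i) ∧ ∀ t, dB.IsRad (g t * dB.e i) := by
  rw [hf] at h
  let Z : AddSubgroup L :=
    { carrier := {x : L | ∃ b, dB.IsRad b ∧ x = D.ιB b * D.ιB (dB.e i)}
      add_mem' := by
        rintro _ _ ⟨b, hb, rfl⟩ ⟨b', hb', rfl⟩
        exact ⟨b + b', dB.isRad_add hb hb', by rw [map_add, add_mul]⟩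
      zero_mem' := ⟨0, dB.isRad_zero, by simp⟩
      neg_mem' := by
        rintro _ ⟨b, hb, rfl⟩
        exact ⟨-b, dB.isRad_neg hb, by rw [map_neg, neg_mul]⟩ }
  have hZ : BStable D Z := by
    rintro b _ ⟨b', hb', rfl⟩
    exact ⟨b * b', (hB.mul_rad hb' b).2, by rw [map_mul, smul_eq_mul, mul_assoc]⟩
  obtain ⟨z₀, ⟨b₀, hb₀, rfl⟩, z, hz, hze, he⟩ := span_decomp (T := T) hB hC hZ h
  choose w hw hwz using hz
  have := uniq D T (b * dB.e i - b₀ * dB.e i)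
    (fun t => g t * dB.e i - dB.e (T.s t) * (w t * dB.e i)) (fun t => by
      rw [mul_sub, ← mul_assoc, hg, ← mul_assoc (dB.e _) (dB.e _), dB.e_self]) (by
      rw [add_mul, Finset.sum_mul] at he
      have h1 : ∀ t, D.ιC (T.c t) * D.ιB (g t * dB.e i - dB.e (T.s t) * (w t * dB.e i)) =
          D.ιC (T.c t) * D.ιB (g t) * D.ιB (dB.e i) - D.ιC (T.c t) • z t := by
        intro t
        rw [hwz, map_sub, mul_sub, map_mul, map_mul, ← mul_assoc, ← mul_assoc, src_ι, map_mul,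
          smul_eq_mul]
      rw [Finset.sum_congr rfl fun t _ => h1 t]
      simp only [Finset.sum_sub_distrib, map_sub, map_mul]
      rw [← sub_eq_zero] at he
      rw [← he]; abel)
  constructor
  · rw [sub_eq_zero.1 this.1]
    exact (hB.mul_rad hb₀ _).1
  · intro t
    rw [sub_eq_zero.1 (this.2 t)]
    exact (hB.mul_rad (hB.mul_rad (hw t) _).1 _).2

lemma std_form (hs : Function.Surjective f) :
    ∃ X : AddSubgroup (D.std i), BFree D T X ∧ Submodule.span L (X : Set (D.std i)) = ⊤ := by
  let X : AddSubgroup (D.std i) := (f.toAddMonoidHom.comp D.ιB.toRingHom.toAddMonoidHom).range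
  have hX : BStable D X := by
    rintro b _ ⟨b', rfl⟩
    refine ⟨b * b', ?_⟩
    show f (D.ιB (b * b')) = D.ιB b • f (D.ιB b')
    rw [← map_smul, map_mul, smul_eq_mul]
  refine ⟨X, ⟨hX, fun z₀ hz₀ z hz hze h => ?_⟩, ?_⟩
  · obtain ⟨b, rfl⟩ := hz₀
    choose g hg using hz
    have hg' : ∀ t, f (D.ιB (g t)) = z t := hg
    have h2 : ∀ t, f (D.ιB (dB.e (T.s t) * g t)) = z t := fun t => by
      rw [map_mul, ← smul_eq_mul, map_smul, hg', hze]
    have := stdMk_uniq (T := T) hB hC hf b (fun t => dB.e (T.s t) * g t)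
      (fun t => by rw [← mul_assoc, dB.e_self]) (by
        rw [map_add, map_sum, ← h]
        congr 1
        refine Finset.sum_congr rfl fun t _ => ?_
        rw [← smul_eq_mul, map_smul, h2])
    exact ⟨stdMk_rad hf this.1, fun t => by rw [← h2 t]; exact stdMk_rad hf (this.2 t)⟩
  · rw [eq_top_iff]
    intro x _
    obtain ⟨l, rfl⟩ := hs x
    rw [← mul_one l, ← smul_eq_mul, map_smul]
    exact Submodule.smul_mem _ _ (Submodule.subset_span ⟨1, by simp⟩)

lemma std_radB (hs : Function.Surjective f) {b : B} (hb : dB.IsRad b) (x : D.std i) :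
    D.ιB b • x = 0 := by
  obtain ⟨l, rfl⟩ := hs x
  obtain ⟨T⟩ := exists_radBasis dC hC
  obtain ⟨b', g, rfl⟩ := decomp D hC T l
  rw [← map_smul, smul_eq_mul, mul_add, Finset.mul_sum, Finset.sum_eq_zero, add_zero, ← map_mul]
  · exact stdMk_rad hf (hB.mul_rad (hB.mul_rad hb _).1 _).1
  · intro t _
    rw [← mul_assoc, D.radMul _ _ hb (T.rad t), zero_mul]

lemma std_C_inj {c : C} (hce : c * dC.e i = c) (h : f (D.ιC c) = 0) : c = 0 := by
  obtain ⟨T⟩ := exists_radBasis dC hC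
  obtain ⟨κ, μ, rfl⟩ := expandC hC T c
  have hz : ∀ (k : K) (p : Fin n), dB.IsRad (k • dB.e p) → k • dC.e p = 0 := by
    intro k p h
    have h1 := h p
    rw [mul_smul_comm, dB.e_self, smul_mul_assoc, dB.e_self] at h1
    apply D.injC
    rw [map_smul, ← D.idem, ← map_smul, h1, map_zero, map_zero]
  have hmul : ∀ (k : K) (p : Fin n), dB.IsRad (k • dB.e p * dB.e i) → k • dC.e p * dC.e i = 0 := by
    intro k p h
    rcases eq_or_ne p i with rfl | hp
    · rw [smul_mul_assoc, dB.e_self] at h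
      rw [hz k p h, zero_mul]
    · rw [smul_mul_assoc, dC.e_ne hp, smul_zero]
  have h2 := stdMk_uniq (T := T) hB hC hf (∑ p, κ p • dB.e p) (fun t => μ t • dB.e (T.s t))
    (fun t => by rw [mul_smul_comm, dB.e_self]) (by
      rw [← h]
      congr 1
      simp only [map_add, map_sum, map_smul, D.idem, mul_smul_comm]
      congr 1
      refine Finset.sum_congr rfl fun t _ => ?_
      rw [← map_mul, T.src])
  rw [← hce, add_mul, Finset.sum_mul, Finset.sum_mul, Finset.sum_eq_zero, Finset.sum_eq_zero,
    add_zero]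
  · intro t _
    rw [← T.src t, ← mul_smul_comm, mul_assoc, hmul _ _ (h2.2 t), mul_zero]
  · intro p _
    refine hmul _ _ fun q => ?_
    rcases eq_or_ne p i with rfl | hp
    · have h3 := h2.1
      rw [Finset.sum_mul, Finset.sum_eq_single p] at h3
      · exact h3 q
      · intro r _ hr
        rw [smul_mul_assoc, dB.e_ne hr, smul_zero]
      · simp
    · rw [smul_mul_assoc, dB.e_ne hp]; simp

lemma std_C_surj (hs : Function.Surjective f) (x : D.std i) :
    ∃ c, c * dC.e i = c ∧ f (D.ιC c) = x := by
  suffices ∃ c, f (D.ιC c) = x by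
    obtain ⟨c, hc⟩ := this
    refine ⟨c * dC.e i, by rw [mul_assoc, dC.e_self], ?_⟩
    rw [map_mul, ← D.idem, stdMk_e hf, hc]
  obtain ⟨l, rfl⟩ := hs x
  have hl : l ∈ Submodule.span K {x : L | ∃ c b, x = D.ιC c * D.ιB b} := by
    rw [D.spans]; trivial
  induction hl using Submodule.span_induction with
  | mem x hx =>
    obtain ⟨c, b, rfl⟩ := hx
    obtain ⟨κ, hκ⟩ := IdemData.diag_of hB.2.2 b
    refine ⟨c * ∑ p, κ p • dC.e p, ?_⟩
    have h1 := stdMk_rad (D := D) hf (hB.mul_rad hκ (dB.e i)).1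
    rw [map_sub, map_sub, sub_eq_zero] at h1
    rw [← smul_eq_mul (D.ιC c), map_smul, h1, ← map_smul, smul_eq_mul]
    simp only [map_mul, map_sum, map_smul, D.idem]
  | zero => exact ⟨0, by simp⟩
  | add x y _ _ hx hy =>
    obtain ⟨c₁, e₁⟩ := hx
    obtain ⟨c₂, e₂⟩ := hy
    exact ⟨c₁ + c₂, by rw [map_add, map_add, e₁, e₂, map_add]⟩
  | smul k x _ hx =>
    obtain ⟨c₁, e₁⟩ := hx
    refine ⟨k • c₁, ?_⟩
    rw [map_smul, ← one_mul (D.ιC c₁), ← smul_mul_assoc, ← smul_eq_mul, map_smul, e₁, ← map_smul,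
      smul_eq_mul, smul_mul_assoc, one_mul]

end

end stdmod

/-- Conclusion 2 for one term. -/
lemma hom_iso {K : Type} [Field K] {n : ℕ}
    {B C A L : Type} [Ring B] [Algebra K B] [Ring C] [Algebra K C] [Ring A] [Algebra K A]
    [Ring L] [Algebra K L]
    {dB : IdemData K n B} {dC : IdemData K n C} {dA : IdemData K n A}
    (hB : dB.Directed) (hC : dC.Codirected)
    (op : A ≃ₗ[K] C) (hop : ∀ x y, op (x * y) = op y * op x) (hope : ∀ i, op (dA.e i) = dC.e i)
    (D : DualExt K n B C L dB dC)
    {dL : IdemData K n L} (hdL : ∀ i, dL.e i = D.ιB (dB.e i)) (j : Fin n)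
    {Q : Type} [AddCommGroup Q] [Module L Q] (m : Fin n → ℕ)
    (Y : Coord dL (Σ ℓ, Fin (m ℓ)) (fun x => x.1) Q) :
    Nonempty ((Q →ₗ[L] D.std j) ≃ₗ[K]
        (∀ ℓ : Fin n, Fin (m ℓ) → ↥(cornerSpace K (dA.e j) (dA.e ℓ)))) := by
  obtain ⟨f, hs, hf⟩ := exists_stdMk D j
  let F : (∀ ℓ : Fin n, Fin (m ℓ) → ↥(cornerSpace K (dA.e j) (dA.e ℓ))) →ₗ[K] (Q →ₗ[L] D.std j) :=
    { toFun := fun x => ∑ i, (Y.a i).smulRight (f (D.ιC (op (x i.1 i.2 : A))))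
      map_add' := fun x y => by
        ext q
        simp [Finset.sum_add_distrib]
      map_smul' := fun k x => by
        ext q
        simp only [Pi.smul_apply, Submodule.coe_smul, map_smul, LinearMap.sum_apply,
          LinearMap.smulRight_apply, LinearMap.smul_apply, RingHom.id_apply,
          LinearMap.map_smul_of_tower, Finset.smul_sum]
        exact Finset.sum_congr rfl fun i _ => smul_comm _ _ _ }
  have hF : ∀ x q, F x q = ∑ i, Y.a i q • f (D.ιC (op (x i.1 i.2 : A))) := fun x q => by
    simp [F]
  have hcor : ∀ ℓ (a : A), a ∈ cornerSpace K (dA.e j) (dA.e ℓ) →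
      dC.e ℓ * op a = op a ∧ op a * dC.e j = op a := by
    intro ℓ a ha
    have ha' : dA.e j * a * dA.e ℓ = a := ha
    have h2 : dC.e ℓ * (op a * dC.e j) = op a := by
      conv_rhs => rw [← ha', hop, hop, hope, hope]
    constructor
    · rw [← h2, ← mul_assoc, dC.e_self]
    · rw [← h2, mul_assoc, mul_assoc, dC.e_self]
  have hFg : ∀ x i, F x (Y.g i) = f (D.ιC (op (x i.1 i.2 : A))) := by
    intro x i
    rw [hF, Finset.sum_eq_single i]
    · rw [Y.a_g, ← map_smul, smul_eq_mul, hdL, D.idem, ← map_mul, (hcor _ _ (x i.1 i.2).2).1]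
    · intro k _ hk
      rw [Y.a_g_ne k i hk, zero_smul]
    · simp
  refine ⟨(LinearEquiv.ofBijective F ⟨?_, ?_⟩).symm⟩
  · rw [← LinearMap.ker_eq_bot, LinearMap.ker_eq_bot']
    intro x hx
    funext ℓ s
    have h1 := hFg x ⟨ℓ, s⟩
    rw [hx, LinearMap.zero_apply] at h1
    have h2 := std_C_inj hB hC hf (hcor _ _ (x ℓ s).2).2 h1.symm
    exact Subtype.ext (op.map_eq_zero_iff.1 h2)
  · intro φ
    have h1 : ∀ i : (Σ ℓ, Fin (m ℓ)), ∃ a : A, a ∈ cornerSpace K (dA.e j) (dA.e i.1) ∧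
        f (D.ιC (op a)) = φ (Y.g i) := by
      intro i
      obtain ⟨c, hc, h⟩ := std_C_surj hB hC hf hs (φ (Y.g i))
      refine ⟨op.symm (dC.e i.1 * c), ?_, ?_⟩
      · show dA.e j * _ * dA.e i.1 = _
        apply op.injective
        rw [hop, hop, hope, hope, op.apply_symm_apply, mul_assoc, hc, ← mul_assoc, dC.e_self]
      · rw [op.apply_symm_apply, map_mul, ← smul_eq_mul, map_smul, h, ← D.idem, ← hdL, ← map_smul,
          Y.e_g]
    choose a ha hfa using h1
    refine ⟨fun ℓ s => ⟨a ⟨ℓ, s⟩, ha ⟨ℓ, s⟩⟩, ?_⟩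
    ext q
    rw [hF]
    conv_rhs => rw [← Y.sum_a q, map_sum]
    refine Finset.sum_congr rfl fun i _ => ?_
    rw [map_smul, ← hfa]

end helpers

/-- Proposition 3.2 of the paper.
Let `B` and `A` be directed algebras (we write `C = A^op`, codirected, and `op : A ≃ C` the
canonical anti-isomorphism), let `Λ = 𝒜(B, A^op)` be the dual extension algebra and let
`P_B^• → L_B(i)` be a minimal projective resolution with terms
`P_B^k = ⊕_{ℓ} P_B(ℓ)^{⊕ m ℓ k}`.  The induced complex `Λ ⊗_B P_B^• → Δ_Λ(i)` is a minimal
projective resolution with terms `Q^k = ⊕_ℓ P_Λ(ℓ)^{⊕ m ℓ k}`; this is the resolution `Q`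
below.  Then, for every `j` and every `k ≥ 0`:
* the complex `Hom_Λ(Λ ⊗_B P_B^•, Δ_Λ(j))` computing `Ext^k_Λ(Δ_Λ(i), Δ_Λ(j))` has zero
  differential (conclusion 1), so that `Ext^k_Λ(Δ_Λ(i), Δ_Λ(j)) ≅ Hom_Λ(Q^k, Δ_Λ(j))`; and
* there is an isomorphism of `K`-vector spaces
  `Ext^k_Λ(Δ_Λ(i), Δ_Λ(j)) ≅ ⊕_{ℓ} (e j * A * e ℓ)^{⊕ m ℓ k}` (conclusion 2). -/
theorem statement1
    (K : Type) [Field K] [IsAlgClosed K] (n : ℕ)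
    (B C A L : Type) [Ring B] [Algebra K B] [Ring C] [Algebra K C] [Ring A] [Algebra K A]
    [Ring L] [Algebra K L]
    (dB : IdemData K n B) (dC : IdemData K n C) (dA : IdemData K n A)
    (hB : dB.Directed) (hC : dC.Codirected) (hA : dA.Directed)
    -- `C = A^op`:
    (op : A ≃ₗ[K] C) (hop : ∀ x y, op (x * y) = op y * op x) (hope : ∀ i, op (dA.e i) = dC.e i)
    (D : DualExt K n B C L dB dC)
    -- the idempotents of `Λ`
    (dL : IdemData K n L) (hdL : ∀ i, dL.e i = D.ιB (dB.e i))
    (i j : Fin n)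
    -- a copy of the simple `B`-module `L_B(i)`
    (Si : Type) [AddCommGroup Si] [Module B Si] (hSi : dB.IsSimpleAt i Si)
    -- the multiplicities `m ℓ k` of `P_B(ℓ)` in the `k`-th term of the minimal resolution
    (m : Fin n → ℕ → ℕ)
    -- a minimal projective resolution `P_B^• → L_B(i)` with terms `⊕_ℓ P_B(ℓ)^{⊕ m ℓ k}`
    (PB : ProjRes K B Si) (hPBmin : PB.Minimal dB)
    (hPBterms : ∀ k, Nonempty
      (PB.P k ≃ₗ[B] ∀ ℓ : Fin n, Fin (m ℓ k) → ↥(leftIdeal (dB.e ℓ))))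
    -- the induced minimal projective resolution `Λ ⊗_B P_B^• → Δ_Λ(i)`,
    -- with terms `⊕_ℓ P_Λ(ℓ)^{⊕ m ℓ k}` (Lemma 3.1 of the paper)
    (Q : ProjRes K L (D.std i)) (hQmin : Q.Minimal dL)
    (hQterms : ∀ k, Nonempty
      (Q.P k ≃ₗ[L] ∀ ℓ : Fin n, Fin (m ℓ k) → ↥(leftIdeal (dL.e ℓ)))) :
    (∀ (k : ℕ) (φ : Q.P k →ₗ[L] D.std j), φ.comp (Q.d k) = 0) ∧
    (∀ k : ℕ, Nonempty
      ((Q.P k →ₗ[L] D.std j) ≃ₗ[K]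
        (∀ ℓ : Fin n, Fin (m ℓ k) → ↥(cornerSpace K (dA.e j) (dA.e ℓ))))) := by
  classical
  obtain ⟨T⟩ := exists_radBasis dC hC
  have Y : ∀ k, Coord dL (Σ ℓ, Fin (m ℓ k)) (fun x => x.1) (Q.P k) := fun k =>
    coordOf (fun ℓ => m ℓ k) (hQterms k).some
  refine ⟨?_, fun k => hom_iso hB hC op hop hope D hdL j (fun ℓ => m ℓ k) (Y k)⟩
  have main : ∀ k, (∃ Z : AddSubgroup (Q.P k), BFree D T Z ∧
      LinearMap.range (Q.d k) = Submodule.span L (Z : Set (Q.P k))) ∧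
      LinearMap.range (Q.d k) ≤
        Submodule.span L {x : Q.P k | ∃ b y, dB.IsRad b ∧ x = D.ιB b • y} := by
    intro k
    induction k with
    | zero =>
      obtain ⟨f, hs, hf⟩ := exists_stdMk D i
      obtain ⟨X, hX, hXt⟩ := std_form (T := T) hB hC hf hs
      have := key_step hB hC hdL (Y 0) Q.aug X hX
        (by rw [hXt, LinearMap.range_eq_top]; exact Q.aug_surj)
        (by rw [Q.exact0]; exact hQmin 0)
      rwa [Q.exact0] at this
    | succ k ih =>
      obtain ⟨⟨X, hX, hr⟩, -⟩ := ih
      have := key_step hB hC hdL (Y (k + 1)) (Q.d k) X hX hr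
        (by rw [Q.exact k]; exact hQmin (k + 1))
      rwa [Q.exact k] at this
  intro k φ
  obtain ⟨f, hs, hf⟩ := exists_stdMk D j
  have hle : LinearMap.range (Q.d k) ≤ LinearMap.ker φ := by
    refine (main k).2.trans ?_
    rw [Submodule.span_le]
    rintro _ ⟨b, y, hb, rfl⟩
    show φ _ = 0
    rw [map_smul, std_radB hB hC hf hs hb]
  ext q
  exact hle ⟨q, rfl⟩
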